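/- Let R be a commutative ring, m ≥ 1, and I₁,…,I_m ideals of R. In the polynomial ring R[t] set Kᵢ := Iᵢ·R[t] + (t). Then for all natural numbers n₁,…,n_m, the intersection K₁^{n₁+1}·K₂^{n₂+1}⋯K_m^{n_m+1} ∩ (t) is contained in the product ideal t·(K₁^{n₁}·K₂^{n₂}⋯K_m^{n_m}) (the product of the principal ideal (t) with K₁^{n₁}⋯K_m^{n_m}). -/

import Mathlib

open Polynomial

theorem Ideal.sup_pow_succ_le {S : Type*} [CommSemiring S] (L T : Ideal S) (n : ℕ) :
    (L ⊔ T) ^ (n + 1) ≤ L ^ (n + 1) ⊔ T * (L ⊔ T) ^ n := by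
  induction n with
  | zero => simp
  | succ n ih =>
    calc (L ⊔ T) ^ (n + 2) = (L ⊔ T) ^ (n + 1) * (L ⊔ T) := pow_succ _ _
      _ ≤ (L ^ (n + 1) ⊔ T * (L ⊔ T) ^ n) * (L ⊔ T) := Ideal.mul_mono_left ih
      _ = L ^ (n + 1) * L ⊔ T * L ^ (n + 1) ⊔ T * (L ⊔ T) ^ (n + 1) := by
        rw [Ideal.sup_mul, Ideal.mul_sup (L ^ (n + 1)), mul_assoc, ← pow_succ,
          mul_comm (L ^ (n + 1)) T, ← pow_succ]
      _ ≤ L ^ (n + 2) ⊔ T * (L ⊔ T) ^ (n + 1) := by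
        rw [← pow_succ]
        exact sup_le (sup_le le_sup_left
          ((Ideal.mul_mono_right (Ideal.pow_right_mono le_sup_left _)).trans le_sup_right))
          le_sup_right

theorem Ideal.prod_sup_pow_succ_le {S ι : Type*} [CommSemiring S] (s : Finset ι)
    (L : ι → Ideal S) (T : Ideal S) (n : ι → ℕ) :
    ∏ i ∈ s, (L i ⊔ T) ^ (n i + 1) ≤
      (∏ i ∈ s, L i ^ (n i + 1)) ⊔ T * ∏ i ∈ s, (L i ⊔ T) ^ n i := by
  classical
  induction s using Finset.induction_on with
  | empty => simp
  | insert a s ha ih =>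
    simp only [Finset.prod_insert ha]
    set P := ∏ i ∈ s, L i ^ (n i + 1)
    set Q := ∏ i ∈ s, (L i ⊔ T) ^ n i
    have hP : P ≤ Q := Finset.prod_le_prod' fun i _ =>
      (Ideal.pow_le_pow_right (Nat.le_succ _)).trans (Ideal.pow_right_mono le_sup_left _)
    refine (Ideal.mul_mono (Ideal.sup_pow_succ_le (L a) T (n a)) ih).trans ?_
    rw [Ideal.sup_mul, Ideal.mul_sup, Ideal.mul_sup]
    have hL : L a ^ (n a + 1) ≤ (L a ⊔ T) ^ n a :=
      (Ideal.pow_le_pow_right (Nat.le_succ _)).trans (Ideal.pow_right_mono le_sup_left _)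
    refine sup_le (sup_le le_sup_left (le_sup_of_le_right ?_))
      (sup_le (le_sup_of_le_right ?_) (le_sup_of_le_right ?_))
    · rw [mul_left_comm]
      exact Ideal.mul_mono_right (Ideal.mul_mono_left hL)
    · rw [mul_assoc]
      exact Ideal.mul_mono_right (Ideal.mul_mono_right hP)
    · rw [mul_assoc]
      exact Ideal.mul_mono_right (Ideal.mul_mono_right Ideal.mul_le_right)

theorem Polynomial.mem_map_C_of_X_mul_mem {R : Type*} [CommSemiring R] {J : Ideal R} {p : R[X]}
    (h : X * p ∈ Ideal.map (C : R →+* R[X]) J) : p ∈ Ideal.map (C : R →+* R[X]) J := by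
  rw [Ideal.mem_map_C_iff] at h ⊢
  exact fun k => by simpa using h (k + 1)

/-- For ideals `I₁,…,I_m` of a commutative ring `R`, setting `Kᵢ = Iᵢ·R[t] + (t)` in `R[t]`,
the intersection `K₁^{n₁+1}⋯K_m^{n_m+1} ∩ (t)` is contained in `t·(K₁^{n₁}⋯K_m^{n_m})`. -/
theorem mixed_rees_inter_span_X_le {R : Type*} [CommRing R] (m : ℕ) (hm : 1 ≤ m)
    (I : Fin m → Ideal R) (n : Fin m → ℕ) :
    (∏ i, (Ideal.map (C : R →+* R[X]) (I i) ⊔ Ideal.span {X}) ^ (n i + 1)) ⊓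
        Ideal.span {(X : R[X])} ≤
      Ideal.span {(X : R[X])} *
        ∏ i, (Ideal.map (C : R →+* R[X]) (I i) ⊔ Ideal.span {X}) ^ (n i) := by
  rintro f ⟨hf, hX⟩
  have hprod : ∏ i, Ideal.map (C : R →+* R[X]) (I i) ^ (n i + 1) =
      Ideal.map C (∏ i, I i ^ (n i + 1)) := by
    simp only [← Ideal.map_pow]
    exact (map_prod (Ideal.mapHom (C : R →+* R[X])) _ _).symm
  obtain ⟨a, ha, b, hb, rfl⟩ :=
    Submodule.mem_sup.mp (Ideal.prod_sup_pow_succ_le Finset.univ _ _ n hf)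
  refine add_mem ?_ hb
  obtain ⟨c, rfl⟩ := Ideal.mem_span_singleton.mp
    ((Ideal.add_mem_iff_left _ (Ideal.mul_le_left hb)).mp hX)
  rw [hprod] at ha
  have hc := mem_map_C_of_X_mul_mem ha
  rw [← hprod] at hc
  exact Ideal.mul_mem_mul (Ideal.mem_span_singleton_self X) (Finset.prod_le_prod' (fun i _ =>
    (Ideal.pow_le_pow_right (Nat.le_succ _)).trans (Ideal.pow_right_mono le_sup_left _)) hc)
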